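/- arXiv:1705.04630 — 2 statements merged into one kernel-verified Lean document; each statement's English description precedes it below -/
import Mathlib

section
/- Let M ⊆ P(O^ω), let M_n : O^n → 2^{P(O^ω)} be a regular upper bound for M|pr_n for each n, and let ε > 0. Let S be a gambling strategy such that for each n and y ∈ O^n, S_n(y) is (M_n(y), ε)-savvy with respect to ρ_n, and let F be a forecaster that dominates the gambler PG S. Then for every μ ∈ M and μ-almost every x ∈ O^ω: limsup_{n→∞} D^{ρ_n}(F_n(x_{:n}), M_n(x_{:n})) ≤ ε. -/
open MeasureTheory Filter Set Topology
open scoped NNReal ENNReal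

noncomputable section

/-- The completion of the ambient σ-algebra with respect to a measure `μ`:
the σ-algebra of `μ`-null-measurable sets. -/
def completionMS {Y : Type*} [MeasurableSpace Y] (μ : Measure Y) : MeasurableSpace Y where
  MeasurableSet' s := NullMeasurableSet s μ
  measurableSet_empty := MeasurableSet.empty.nullMeasurableSet
  measurableSet_compl := fun _ h => h.compl
  measurableSet_iUnion := fun _ h => NullMeasurableSet.iUnion h

/-- The σ-algebra of universally measurable sets: the intersection of the completions
of the ambient (Borel) σ-algebra with respect to all probability measures. -/
def univMS (Y : Type*) [MeasurableSpace Y] : MeasurableSpace Y :=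
  ⨅ (μ : Measure Y) (_ : IsProbabilityMeasure μ), completionMS μ

/-- The support of a probability measure: the set of points all of whose open
neighbourhoods have positive measure. -/
def msupp {X : Type*} [TopologicalSpace X] [MeasurableSpace X] (μ : ProbabilityMeasure X) :
    Set X :=
  {x | ∀ U : Set X, IsOpen U → x ∈ U → 0 < μ.toMeasure U}

/-- `ρ` is a metrization of the topological space `X`: it is a metric and the
neighbourhood filters are generated by its open balls. -/
structure IsMetrization {X : Type*} [TopologicalSpace X] (ρ : X → X → ℝ) : Prop where
  refl : ∀ x, ρ x x = 0
  pos : ∀ x y, x ≠ y → 0 < ρ x y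
  symm : ∀ x y, ρ x y = ρ y x
  triangle : ∀ x y z, ρ x z ≤ ρ x y + ρ y z
  nhds_basis : ∀ x : X, (nhds x).HasBasis (fun ε : ℝ => 0 < ε) (fun ε => {y | ρ x y < ε})

/-- `f` is Lipschitz with respect to the metric `ρ`. -/
def LipWrt {X : Type*} (ρ : X → X → ℝ) (f : X → ℝ) : Prop :=
  ∃ K : ℝ, ∀ x y, |f x - f y| ≤ K * ρ x y

/-- The norm `‖f‖_ρ := max_x |f x| + sup_{x ≠ y} |f x - f y| / ρ x y` on Lipschitz functions. -/
def lipNorm {X : Type*} (ρ : X → X → ℝ) (f : X → ℝ) : ℝ :=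
  (⨆ x, |f x|) + sSup {c | ∃ x y, x ≠ y ∧ c = |f x - f y| / ρ x y}

/-- The Kantorovich-Rubinstein distance
`D^ρ(μ, ν) := sup {E_μ[f] - E_ν[f] | f Lipschitz, ‖f‖_ρ ≤ 1}`. -/
def KRdist {X : Type*} [MeasurableSpace X] (ρ : X → X → ℝ) (μ ν : ProbabilityMeasure X) : ℝ :=
  sSup {c | ∃ f : X → ℝ, LipWrt ρ f ∧ lipNorm ρ f ≤ 1 ∧
    c = (∫ x, f x ∂(μ : Measure X)) - ∫ x, f x ∂(ν : Measure X)}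

/-- The Kantorovich-Rubinstein distance from a measure to a set of measures. -/
def KRdistSet {X : Type*} [MeasurableSpace X] (ρ : X → X → ℝ) (μ : ProbabilityMeasure X)
    (A : Set (ProbabilityMeasure X)) : ℝ :=
  sInf {c | ∃ ν ∈ A, c = KRdist ρ μ ν}

/-- Convexity for a set of probability measures. -/
def ConvexPM {X : Type*} [MeasurableSpace X] (A : Set (ProbabilityMeasure X)) : Prop :=
  ∀ μ ∈ A, ∀ ν ∈ A, ∀ p : ℝ≥0, p ≤ 1 → ∀ ξ : ProbabilityMeasure X,
    (ξ : Measure X) = p • (μ : Measure X) + (1 - p) • (ν : Measure X) → ξ ∈ A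

/-- `κ` is a regular conditional probability for `μ` given `π`: it is a measurable family
of probability measures which disintegrates `μ` over `π_* μ` and is concentrated on fibers. -/
def IsRCP {X Y : Type*} [MeasurableSpace X] [MeasurableSpace Y]
    (μ : Measure X) (π : X → Y) (κ : Y → ProbabilityMeasure X) : Prop :=
  Measurable (fun y => (κ y : Measure X)) ∧
  (∀ s : Set X, MeasurableSet s → ∀ t : Set Y, MeasurableSet t →
    μ (s ∩ π ⁻¹' t) = ∫⁻ y in t, (κ y : Measure X) s ∂(μ.map π)) ∧
  (∀ᵐ y ∂(μ.map π), (κ y : Measure X) (π ⁻¹' {y}) = 1)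

/-- `N` is a regular upper bound for `M | π` (Definition 2.2 of the paper). -/
structure IsRUB {X Y : Type*} [TopologicalSpace X] [TopologicalSpace Y]
    [MeasurableSpace X] [MeasurableSpace Y] [OpensMeasurableSpace X]
    (π : X → Y) (M : Set (ProbabilityMeasure X)) (N : Y → Set (ProbabilityMeasure X)) : Prop where
  closed : IsClosed {p : Y × ProbabilityMeasure X | p.2 ∈ N p.1}
  convex : ∀ y, ConvexPM (N y)
  cond : ∀ μ ∈ M, ∀ κ : Y → ProbabilityMeasure X, IsRCP (μ : Measure X) π κ →
    ∀ᵐ y ∂((μ : Measure X).map π), κ y ∈ N y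

/-- `β` is an `(M, r₀)`-savvy bet (with respect to the metric `ρ`). -/
def IsSavvy {X : Type*} [TopologicalSpace X] [MeasurableSpace X] [OpensMeasurableSpace X]
    (ρ : X → X → ℝ) (M : Set (ProbabilityMeasure X)) (r₀ : ℝ)
    (β : ProbabilityMeasure X × X → ℝ) : Prop :=
  Continuous β ∧
  ∀ μ : ProbabilityMeasure X,
    (∀ x, |β (μ, x)| ≤ max (KRdistSet ρ μ M - r₀) 0) ∧
    ∀ ν ∈ M, (1/2) * (KRdistSet ρ μ M - r₀) * KRdistSet ρ μ M ≤
      (∫ x, β (μ, x) ∂(ν : Measure X)) - ∫ x, β (μ, x) ∂(μ : Measure X)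

/-- Borel σ-algebra on the space of probability measures (with its weak topology). -/
instance {X : Type*} [TopologicalSpace X] [MeasurableSpace X] [OpensMeasurableSpace X] :
    MeasurableSpace (ProbabilityMeasure X) := borel _

/-- Borel σ-algebra on a space of continuous functions. -/
instance {Y : Type*} [TopologicalSpace Y] : MeasurableSpace C(Y, ℝ) := borel _

end
noncomputable section

variable (O : ℕ → Type*) [∀ n, TopologicalSpace (O n)] [∀ n, CompactSpace (O n)]
  [∀ n, PolishSpace (O n)] [∀ n, MeasurableSpace (O n)] [∀ n, BorelSpace (O n)]

/-- The space `O^n` of observation histories of length `n`. -/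
abbrev Hn (n : ℕ) : Type _ := ∀ i : Fin n, O i

/-- The space `O^ω` of infinite observation sequences. -/
abbrev Hw : Type _ := ∀ n : ℕ, O n

/-- The projection `O^ω → O^n`, `x ↦ x_{:n}`. -/
def proj (n : ℕ) : Hw O → Hn O n := fun x i => x i

/-- The cylinder `yO^ω` over `y ∈ O^n`. -/
def cyl (n : ℕ) (y : Hn O n) : Set (Hw O) := {x | proj O n x = y}

/-- Truncation `O^n → O^m` for `m ≤ n`. -/
def trunc {m n : ℕ} (h : m ≤ n) (y : Hn O n) : Hn O m := fun i => y (i.castLE h)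

/-- The payoff `(Vβ)(μ, x) := β(μ, x) - E_{x' ∼ μ}[β(μ, x')]` of a bet `β`. -/
def Vbet {X : Type*} [MeasurableSpace X]
    (β : ProbabilityMeasure X × X → ℝ) (μ : ProbabilityMeasure X) (x : X) : ℝ :=
  β (μ, x) - ∫ x', β (μ, x') ∂(μ : Measure X)

/-- The sup norm of a bet. -/
def gmNorm {X : Type*} [MeasurableSpace X] (β : ProbabilityMeasure X × X → ℝ) : ℝ :=
  ⨆ p, |β p|

/-- A forecaster: a family of measurable maps `F_n : O^n → P(O^ω)` (with `O^n` carrying the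
σ-algebra of universally measurable sets), whose forecasts are supported on the observed
cylinder. -/
structure Forecaster where
  F : ∀ n, Hn O n → ProbabilityMeasure (Hw O)
  measurable : ∀ n, @Measurable _ _ (univMS (Hn O n)) inferInstance (F n)
  supp : ∀ n y, msupp (F n y) ⊆ cyl O n y

/-- The (not necessarily continuous or measurable) data of a gambler: for each `n`, a map
assigning to an observation history and a forecast history a bet. -/
abbrev PreGambler : Type _ := ∀ n : ℕ, Hn O n × (Fin n → ProbabilityMeasure (Hw O)) →
  ProbabilityMeasure (Hw O) × Hw O → ℝ

/-- A gambler: a family of measurable maps `G_n : O^n × P(O^ω)^n → Gm(O^ω)`, where `O^n`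
carries the universally measurable σ-algebra, `P(O^ω)^n` the Borel σ-algebra, and the space
`Gm(O^ω) = C(P(O^ω) × O^ω)` of bets the Borel σ-algebra. -/
structure Gambler where
  G : ∀ n : ℕ, Hn O n × (Fin n → ProbabilityMeasure (Hw O)) →
    C(ProbabilityMeasure (Hw O) × Hw O, ℝ)
  measurable : ∀ n, @Measurable _ _ (MeasurableSpace.prod (univMS (Hn O n)) inferInstance)
    inferInstance (G n)

/-- The underlying bet-valued data of a gambler. -/
def Gambler.pre (G : Gambler O) : PreGambler O := fun n yμ p => G.G n yμ p

/-- The forecast history of a forecaster along an observation history. -/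
def fhist (F : ∀ n, Hn O n → ProbabilityMeasure (Hw O)) (n : ℕ) (y : Hn O n) :
    Fin n → ProbabilityMeasure (Hw O) := fun m => F m (trunc O m.isLt.le y)

/-- The total payoff `SV G_n(y, μ̄)(x)` of the first `n` gambles of a gambler `G`,
given forecasts `μ̄` (here `y ∈ O^{n-1}`). -/
def SVg (G : PreGambler O) (n : ℕ) (y : Hn O (n-1))
    (μs : Fin n → ProbabilityMeasure (Hw O)) (x : Hw O) : ℝ :=
  ∑ m : Fin n, Vbet (G m (trunc O (Nat.le_pred_of_lt m.isLt) y,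
      fun i : Fin m => μs (i.castLE m.isLt.le)))
    (μs m) x

/-- The minimal total payoff `SVmin G_n(y, μ̄)` over the cylinder `yO^ω`. -/
def SVgMin (G : PreGambler O) (n : ℕ) (y : Hn O (n-1))
    (μs : Fin n → ProbabilityMeasure (Hw O)) : ℝ :=
  sInf (SVg O G n y μs '' cyl O (n-1) y)

/-- The maximal total payoff `SVmax G_n(y, μ̄)` over the cylinder `yO^ω`. -/
def SVgMax (G : PreGambler O) (n : ℕ) (y : Hn O (n-1))
    (μs : Fin n → ProbabilityMeasure (Hw O)) : ℝ :=
  sSup (SVg O G n y μs '' cyl O (n-1) y)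

/-- The total payoff `SV G^F_n(x)` of the first `n` gambles of a gambler `G` playing
against a forecaster `F`, along the observation sequence `x`. -/
def SVf (G : PreGambler O) (F : ∀ n, Hn O n → ProbabilityMeasure (Hw O)) (n : ℕ)
    (x : Hw O) : ℝ :=
  ∑ m : Fin n, Vbet (G m (proj O m x, fhist O F m (proj O m x))) (F m (proj O m x)) x

/-- The minimal total payoff `SVmin G^F_n(y)` over the cylinder `yO^ω`, `y ∈ O^{n-1}`. -/
def SVfMin (G : PreGambler O) (F : ∀ n, Hn O n → ProbabilityMeasure (Hw O)) (n : ℕ)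
    (y : Hn O (n-1)) : ℝ :=
  sInf (SVf O G F n '' cyl O (n-1) y)

/-- The maximal total payoff `SVmax G^F_n(y)` over the cylinder `yO^ω`, `y ∈ O^{n-1}`. -/
def SVfMax (G : PreGambler O) (F : ∀ n, Hn O n → ProbabilityMeasure (Hw O)) (n : ℕ)
    (y : Hn O (n-1)) : ℝ :=
  sSup (SVf O G F n '' cyl O (n-1) y)

/-- A forecaster (given by its family of forecasts) dominates a gambler when, along every
observation sequence, if the gambler's minimal total payoff is bounded below then its
maximal total payoff is bounded above. -/
def Dominates (F : ∀ n, Hn O n → ProbabilityMeasure (Hw O)) (G : PreGambler O) : Prop :=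
  ∀ x : Hw O,
    BddBelow (Set.range fun n => SVfMin O G F n (proj O (n-1) x)) →
    BddAbove (Set.range fun n => SVfMax O G F n (proj O (n-1) x))

/-- A gambling strategy: a uniformly bounded family of measurable maps `S_n : O^n → Gm(O^ω)`
(not depending on the forecast history). -/
structure Strategy where
  S : ∀ n : ℕ, Hn O n → C(ProbabilityMeasure (Hw O) × Hw O, ℝ)
  measurable : ∀ n, @Measurable _ _ (univMS (Hn O n)) inferInstance (S n)
  bounded : ∃ C : ℝ, ∀ n y p, |S n y p| ≤ C

open scoped Classical in
/-- The gambler `PG S` associated to a gambling strategy `S`: it plays `S` in round `n`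
exactly when the uncertainty about the total payoff of previous bets is at most `1`. -/
def PGfun (S : Strategy O) : (n : ℕ) → Hn O n × (Fin n → ProbabilityMeasure (Hw O)) →
    C(ProbabilityMeasure (Hw O) × Hw O, ℝ)
  | n, yμ =>
    let sv : Hw O → ℝ := fun x =>
      ∑ m : Fin n, Vbet (fun p => PGfun S m
          (trunc O m.isLt.le yμ.1, fun i : Fin m => yμ.2 (i.castLE m.isLt.le)) p)
        (yμ.2 m) x
    if sSup (sv '' cyl O (n-1) (trunc O (Nat.sub_le n 1) yμ.1)) -
        sInf (sv '' cyl O (n-1) (trunc O (Nat.sub_le n 1) yμ.1)) ≤ 1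
    then S.S n yμ.1 else 0
termination_by n => n
decreasing_by exact m.isLt

/-- The gambler `PG S`, as gambling data. -/
def PGpre (S : Strategy O) : PreGambler O := fun n yμ p => PGfun O S n yμ p

/-- The normalization factor `Nr_b G_n(y, μ̄; ν)` used to enforce a finite budget `b`. -/
def NrFun (G : PreGambler O) (b : ℝ) (n : ℕ) (y : Hn O n)
    (μs : Fin n → ProbabilityMeasure (Hw O)) (ν : ProbabilityMeasure (Hw O)) : ℝ :=
  (max 1 (sSup ((fun x => (-(Vbet (G n (y, μs)) ν x)) /
      (SVg O G n (trunc O (Nat.sub_le n 1) y) μs x + b)) '' cyl O n y)))⁻¹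

open scoped Classical in
/-- The gambler `Bd_b G`: the modification of `G` which never loses more than the budget
`b`. -/
def BdG (G : PreGambler O) (b : ℝ) : PreGambler O := fun n yμ =>
  if ∀ m : Fin n, -b < SVgMin O G (m.1+1) (trunc O m.isLt.le yμ.1)
      (fun i : Fin (m.1+1) => yμ.2 (i.castLE m.isLt)) then
    fun p => NrFun O G b n yμ.1 yμ.2 p.1 * G n yμ p
  else fun _ => 0

/-- A gambling strategy `S` is `μ*`-prudent when, for some `α > 0`, for every round, almost
every observation history and every forecast, the expected payoff of the bet under the true
environment `μ*` exceeds the payoff under the forecast by at least `α` times the spread of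
the bet. -/
def IsPrudent (S : Strategy O) (μstar : ProbabilityMeasure (Hw O)) : Prop :=
  ∃ α : ℝ, 0 < α ∧ ∀ n : ℕ, ∀ κ : Hn O n → ProbabilityMeasure (Hw O),
    IsRCP (μstar : Measure (Hw O)) (proj O n) κ →
      ∀ᵐ y ∂((μstar : Measure (Hw O)).map (proj O n)), ∀ μ : ProbabilityMeasure (Hw O),
        α * (sSup ((fun x => S.S n y (μ, x)) '' cyl O n y) -
             sInf ((fun x => S.S n y (μ, x)) '' cyl O n y)) ≤
          (∫ x, S.S n y (μ, x) ∂(κ y : Measure (Hw O))) -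
            ∫ x, S.S n y (μ, x) ∂(μ : Measure (Hw O))

lemma exp_mul_step {u w : ℝ} (hu : |u| ≤ 1) (hw : |w| ≤ 1) :
    Real.exp (u + w) ≤ Real.exp u + (w + 2 * |u| * |w| + 3 * w ^ 2) := by
  have h1 : |Real.exp u - 1| ≤ 2 * |u| := Real.abs_exp_sub_one_le hu
  have h2 : |Real.exp w - 1 - w| ≤ w ^ 2 := Real.abs_exp_sub_one_sub_id_le hw
  have h3 : Real.exp u ≤ 3 :=
    (Real.exp_le_exp.2 (abs_le.1 hu).2).trans (Real.exp_one_lt_d9.le.trans (by norm_num))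
  have h4 : (Real.exp u - 1) * w ≤ 2 * |u| * |w| := by
    calc _ ≤ |(Real.exp u - 1) * w| := le_abs_self _
      _ = |Real.exp u - 1| * |w| := abs_mul _ _
      _ ≤ _ := by gcongr
  have h5 : Real.exp u * (Real.exp w - 1 - w) ≤ 3 * w ^ 2 := by
    calc _ ≤ Real.exp u * w ^ 2 := by
          gcongr
          exact (abs_le.1 h2).2
      _ ≤ _ := by gcongr
  rw [Real.exp_add]
  linarith

/-- One step of an exponential supermartingale: if the payoff `f` is bounded by `b`, has mean at
least `α * b`, and the past payoff `s` varies by at most `1`, then the exponentially discounted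
payoff does not increase in expectation. -/
lemma integral_exp_step {X : Type*} [MeasurableSpace X] (κ : Measure X) [IsProbabilityMeasure κ]
    {s f : X → ℝ} {b B C α l s₀ : ℝ} (hsm : AEMeasurable s κ) (hfm : AEMeasurable f κ)
    (hs : ∀ᵐ x ∂κ, |s x - s₀| ≤ 1) (hf : ∀ᵐ x ∂κ, |f x| ≤ b) (hb : b ≤ C)
    (hmean : α * b ≤ ∫ x, f x ∂κ) (hα0 : 0 < α) (hα1 : α ≤ 1) (hl0 : 0 < l) (hl1 : l ≤ 1)
    (hl3 : l * (4 + 12 * C) ≤ α / 2) :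
    ∫ x, Real.exp (-l * (s x + f x - α / 2 * (B + b))) ∂κ
      ≤ ∫ x, Real.exp (-l * (s x - α / 2 * B)) ∂κ := by
  have hb0 : 0 ≤ b := by
    obtain ⟨x, hx⟩ := hf.exists
    exact (abs_nonneg _).trans hx
  set K : ℝ := Real.exp (-l * (s₀ - α / 2 * B)) with hK
  have hfi : Integrable f κ :=
    Integrable.of_bound hfm.aestronglyMeasurable b (by simpa using hf)
  have hi1 : Integrable (fun x => Real.exp (-l * (s x - s₀))) κ := by
    refine Integrable.of_bound (by fun_prop) (Real.exp 1) ?_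
    filter_upwards [hs] with x hx
    rw [Real.norm_eq_abs, abs_of_pos (Real.exp_pos _)]
    apply Real.exp_le_exp.2
    have := (abs_le.1 hx).1
    nlinarith
  have hi2 : Integrable (fun x => -l * f x + l * (α / 2) * b) κ := by fun_prop
  have key : ∀ᵐ x ∂κ, Real.exp (-l * (s x + f x - α / 2 * (B + b))) ≤
      K * (Real.exp (-l * (s x - s₀)) + ((-l * f x + l * (α / 2) * b)
        + l ^ 2 * (4 + 12 * C) * b)) := by
    filter_upwards [hs, hf] with x hx hfx
    have e : -l * (s x + f x - α / 2 * (B + b)) = -l * (s₀ - α / 2 * B) +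
      (-l * (s x - s₀) + (-l * f x + l * (α / 2) * b)) := by ring
    rw [e, Real.exp_add]
    have hu' : |-l * (s x - s₀)| ≤ l := by
      rw [abs_mul, abs_neg, abs_of_pos hl0]
      nlinarith [abs_nonneg (s x - s₀)]
    have hw' : |-l * f x + l * (α / 2) * b| ≤ 2 * l * b := by
      have h1 := abs_le.1 hfx
      rw [abs_le]
      constructor <;> nlinarith [mul_nonneg hl0.le hb0, mul_le_mul_of_nonneg_left h1.1 hl0.le,
        mul_le_mul_of_nonneg_left h1.2 hl0.le,
        mul_le_mul_of_nonneg_left hα1 (mul_nonneg hl0.le hb0), 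
        mul_nonneg hα0.le (mul_nonneg hl0.le hb0)]
    have hw1 : 2 * l * b ≤ 1 := by nlinarith
    have := exp_mul_step (hu'.trans hl1) (hw'.trans hw1)
    gcongr
    refine this.trans ?_
    have h1 : 2 * |-l * (s x - s₀)| * |-l * f x + l * (α / 2) * b| ≤ 2 * l * (2 * l * b) := by
      gcongr
    have h2 : (-l * f x + l * (α / 2) * b) ^ 2 ≤ (2 * l * b) ^ 2 := by
      rw [← sq_abs]
      gcongr
    have h3 : (2 * l * b) ^ 2 ≤ 4 * l ^ 2 * (C * b) := by
      nlinarith [mul_le_mul_of_nonneg_right hb hb0, sq_nonneg l]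
    linarith
  have hint : ∫ x, (-l * f x + l * (α / 2) * b) ∂κ = -l * ∫ x, f x ∂κ + l * (α / 2) * b := by
    rw [integral_add (by fun_prop) (by fun_prop), integral_const_mul]
    simp
  calc _ ≤ ∫ x, K * (Real.exp (-l * (s x - s₀)) + ((-l * f x + l * (α / 2) * b)
        + l ^ 2 * (4 + 12 * C) * b)) ∂κ := by
        refine integral_mono_of_nonneg (ae_of_all _ fun _ => (Real.exp_pos _).le) ?_ key
        fun_prop
    _ = K * ((∫ x, Real.exp (-l * (s x - s₀)) ∂κ) + ((-l * ∫ x, f x ∂κ) + l * (α / 2) * b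
        + l ^ 2 * (4 + 12 * C) * b)) := by
        rw [integral_const_mul, integral_add hi1 (by fun_prop),
          integral_add hi2 (by fun_prop), hint]
        simp
    _ ≤ K * ∫ x, Real.exp (-l * (s x - s₀)) ∂κ := by
        have h0 : 0 ≤ K := (Real.exp_pos _).le
        gcongr
        have := mul_le_mul_of_nonneg_left hmean hl0.le
        have h3 := mul_le_mul_of_nonneg_left hl3 (mul_nonneg hl0.le hb0)
        linarith
    _ = _ := by
        rw [← integral_const_mul]
        congr 1 with x
        rw [hK, ← Real.exp_add]
        ring_nf

section

/-- The regular conditional probability of `μ` given the first `n` observations. -/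
def condProj [Nonempty (Hw O)] (μ : Measure (Hw O)) [IsFiniteMeasure μ] (n : ℕ) :
    ProbabilityTheory.Kernel (Hn O n) (Hw O) :=
  ProbabilityTheory.condDistrib id (proj O n) μ

instance [Nonempty (Hw O)] (μ : Measure (Hw O)) [IsFiniteMeasure μ] (n : ℕ) :
    ProbabilityTheory.IsMarkovKernel (condProj O μ n) := by
  unfold condProj
  infer_instance

variable {O}

lemma continuous_proj (n : ℕ) : Continuous (proj O n) := by
  unfold proj
  fun_prop

lemma measurable_proj (n : ℕ) : Measurable (proj O n) := by
  unfold proj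
  fun_prop

lemma compProd_condProj [Nonempty (Hw O)] (μ : Measure (Hw O)) [IsFiniteMeasure μ] (n : ℕ) :
    (μ.map (proj O n)).compProd (condProj O μ n) = μ.map (fun x => (proj O n x, x)) :=
  ProbabilityTheory.compProd_map_condDistrib aemeasurable_id

lemma ae_condProj_fiber [Nonempty (Hw O)] (μ : Measure (Hw O)) [IsFiniteMeasure μ] (n : ℕ) :
    ∀ᵐ y ∂(μ.map (proj O n)), ∀ᵐ x ∂(condProj O μ n y), proj O n x = y := by
  have hm : MeasurableSet {p : Hn O n × Hw O | proj O n p.2 = p.1} :=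
    (isClosed_eq ((continuous_proj n).comp continuous_snd) continuous_fst).measurableSet
  refine Measure.ae_ae_of_ae_compProd (p := fun p : Hn O n × Hw O => proj O n p.2 = p.1) ?_
  rw [compProd_condProj, ae_map_iff (by exact ((measurable_proj n).prodMk measurable_id).aemeasurable) hm]
  simp

/-- `condProj` bundled as a family of probability measures. -/
def condProjPM [Nonempty (Hw O)] (μ : Measure (Hw O)) [IsFiniteMeasure μ] (n : ℕ) (y : Hn O n) :
    ProbabilityMeasure (Hw O) :=
  ⟨condProj O μ n y, inferInstance⟩

lemma coe_condProjPM [Nonempty (Hw O)] (μ : Measure (Hw O)) [IsFiniteMeasure μ] (n : ℕ)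
    (y : Hn O n) : (condProjPM μ n y : Measure (Hw O)) = condProj O μ n y := rfl

lemma isRCP_condProjPM [Nonempty (Hw O)] (μ : Measure (Hw O)) [IsFiniteMeasure μ] (n : ℕ) :
    IsRCP μ (proj O n) (condProjPM μ n) := by
  simp only [IsRCP, coe_condProjPM]
  refine ⟨(condProj O μ n).measurable, fun s hs t ht => ?_, ?_⟩
  · have h := congrArg (fun m => m (t ×ˢ s)) (compProd_condProj μ n)
    beta_reduce at h
    rw [Measure.compProd_apply_prod ht hs, Measure.map_apply
      (by exact (measurable_proj n).prodMk measurable_id) (ht.prod hs)] at h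
    refine Eq.trans ?_ h.symm
    congr 1
    ext x
    simp [and_comm]
  · filter_upwards [ae_condProj_fiber μ n] with y hy
    exact (prob_compl_eq_zero_iff ((measurable_proj n) (measurableSet_singleton y))).1 hy

/-- The filtration of `O^ω` generated by the observation histories. -/
def obsFiltration (O : ℕ → Type*) [∀ n, MeasurableSpace (O n)] :
    Filtration ℕ (inferInstance : MeasurableSpace (Hw O)) where
  seq n := MeasurableSpace.comap (proj O n) inferInstance
  mono' := by
    intro m n h
    have : proj O m = trunc O h ∘ proj O n := rfl
    have ht : Measurable (trunc O h) := by
      unfold trunc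
      fun_prop
    simp only
    rw [this, ← MeasurableSpace.comap_comp]
    exact MeasurableSpace.comap_mono ht.comap_le
  le' := by
    intro n
    have h : Measurable (proj O n) := by
      unfold proj
      fun_prop
    exact h.comap_le

/-- If the conditional expectations of nonnegative `L n` given the first `n` observations do not
increase on passing from `L n` to `L (n + 1)`, then they are almost surely bounded. -/
lemma ae_exists_bound_integral_condProj [Nonempty (Hw O)] (μ : Measure (Hw O))
    [IsProbabilityMeasure μ] (L : ℕ → Hw O → ℝ) (hL0 : ∀ n x, 0 ≤ L n x)
    (hLi : ∀ n, Integrable (L n) μ)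
    (hstep : ∀ n, ∀ᵐ x ∂μ, ∫ z, L (n + 1) z ∂(condProj O μ n (proj O n x)) ≤
      ∫ z, L n z ∂(condProj O μ n (proj O n x))) :
    ∀ᵐ x ∂μ, ∃ R, ∀ n, ∫ z, L n z ∂(condProj O μ n (proj O n x)) ≤ R := by
  have hce : ∀ n k, μ[L k | obsFiltration O n] =ᵐ[μ]
      fun x => ∫ z, L k z ∂(condProj O μ n (proj O n x)) := fun n k =>
    ProbabilityTheory.condExp_ae_eq_integral_condDistrib_id (measurable_proj n) (hLi k)
  set U : ℕ → Hw O → ℝ := fun n => μ[L n | obsFiltration O n] with hU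
  have hsup : Supermartingale U (obsFiltration O) μ := by
    refine supermartingale_nat (fun n => stronglyMeasurable_condExp)
      (fun n => integrable_condExp) fun n => ?_
    have h1 : μ[U (n + 1) | obsFiltration O n] =ᵐ[μ] μ[L (n + 1) | obsFiltration O n] :=
      condExp_condExp_of_le ((obsFiltration O).mono n.le_succ) ((obsFiltration O).le _)
    filter_upwards [h1, hce n n, hce n (n + 1), hstep n] with x hx1 hx2 hx3 hx4
    rw [hx1, hx3, hU]
    simp only
    rw [hx2]
    exact hx4
  have hU0 : ∀ n, 0 ≤ᵐ[μ] U n := fun n => condExp_nonneg (ae_of_all _ (hL0 n))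
  have hUint : ∀ n, ∫ x, U n x ∂μ ≤ ∫ x, U 0 x ∂μ := fun n => by
    have := hsup.setIntegral_le (Nat.zero_le n) (MeasurableSet.univ)
    simpa using this
  have hbdd : ∀ n, eLpNorm ((-U) n) 1 μ ≤ ((∫ x, U 0 x ∂μ).toNNReal : ℝ≥0∞) := fun n => by
    rw [Pi.neg_apply, eLpNorm_neg, eLpNorm_one_eq_lintegral_enorm,
      ← ofReal_integral_norm_eq_lintegral_enorm integrable_condExp]
    refine ENNReal.ofReal_le_ofReal ?_
    rw [integral_congr_ae (g := U n)]
    · exact hUint n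
    · filter_upwards [hU0 n] with x hx
      rw [Real.norm_eq_abs, abs_of_nonneg hx]
  have hall : ∀ᵐ x ∂μ, ∀ n, U n x = ∫ z, L n z ∂(condProj O μ n (proj O n x)) :=
    ae_all_iff.2 fun n => hce n n
  filter_upwards [hsup.neg.ae_tendsto_limitProcess hbdd, hall] with x hx hx2
  obtain ⟨R, hR⟩ := hx.neg.bddAbove_range
  refine ⟨R, fun n => ?_⟩
  rw [← hx2 n]
  simpa using hR (Set.mem_range_self n)

instance {Y : Type*} [TopologicalSpace Y] : BorelSpace C(Y, ℝ) := ⟨rfl⟩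

instance {X : Type*} [TopologicalSpace X] [MeasurableSpace X] [OpensMeasurableSpace X] :
    BorelSpace (ProbabilityMeasure X) := ⟨rfl⟩

section Bets

variable {X : Type*} [TopologicalSpace X] [CompactSpace X] [PolishSpace X] [MeasurableSpace X]
  [BorelSpace X]

lemma integrable_continuousMap (g : C(X, ℝ)) (ν : Measure X) [IsFiniteMeasure ν] :
    Integrable g ν :=
  Integrable.of_bound g.continuous.aestronglyMeasurable ‖g‖ (ae_of_all _ g.norm_coe_le_norm)

lemma abs_integral_sub_le (g h : C(X, ℝ)) (ν : ProbabilityMeasure X) :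
    |(∫ x, g x ∂(ν : Measure X)) - ∫ x, h x ∂(ν : Measure X)| ≤ ‖g - h‖ := by
  rw [← integral_sub (integrable_continuousMap g _) (integrable_continuousMap h _)]
  have := norm_integral_le_of_norm_le_const (μ := (ν : Measure X)) (f := fun x => g x - h x)
    (C := ‖g - h‖) (ae_of_all _ fun x => (g - h).norm_coe_le_norm x)
  simpa using this

lemma continuous_integral_continuousMap (g : C(X, ℝ)) :
    Continuous fun ν : ProbabilityMeasure X => ∫ x, g x ∂(ν : Measure X) :=
  continuous_iff_continuousAt.2 fun _ =>
    (ProbabilityMeasure.tendsto_iff_forall_integral_tendsto.1 tendsto_id)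
      (BoundedContinuousFunction.mkOfCompact g)

lemma continuous_integral_bet (β : C(ProbabilityMeasure X × X, ℝ)) :
    Continuous fun ν : ProbabilityMeasure X => ∫ x, β (ν, x) ∂(ν : Measure X) := by
  refine continuous_iff_continuousAt.2 fun ν₀ => ?_
  have h1 : Tendsto (fun ν => ‖β.curry ν - β.curry ν₀‖) (𝓝 ν₀) (𝓝 0) :=
    tendsto_iff_norm_sub_tendsto_zero.1 (β.curry.continuous.tendsto ν₀)
  have h2 := (continuous_integral_continuousMap (β.curry ν₀)).tendsto ν₀
  have h3 : Tendsto (fun ν : ProbabilityMeasure X =>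
      (∫ x, β.curry ν x ∂(ν : Measure X)) - ∫ x, β.curry ν₀ x ∂(ν : Measure X)) (𝓝 ν₀) (𝓝 0) :=
    squeeze_zero_norm (fun ν => abs_integral_sub_le _ _ _) h1
  have := h3.add h2
  simp only [sub_add_cancel, zero_add] at this
  exact this

lemma continuous_integral_bet_right (ν : ProbabilityMeasure X) :
    Continuous fun β : C(ProbabilityMeasure X × X, ℝ) => ∫ x, β (ν, x) ∂(ν : Measure X) := by
  refine (LipschitzWith.of_dist_le_mul (K := 1) fun β γ => ?_).continuous
  rw [Real.dist_eq, NNReal.coe_one, one_mul, dist_eq_norm]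
  refine (abs_integral_sub_le (β.curry ν) (γ.curry ν) ν).trans ?_
  refine (ContinuousMap.norm_le _ (norm_nonneg _)).2 fun x => ?_
  exact (β - γ).norm_coe_le_norm (ν, x)

lemma continuous_Vbet (β : C(ProbabilityMeasure X × X, ℝ)) (ν : ProbabilityMeasure X) :
    Continuous (Vbet (fun p => β p) ν) := by
  unfold Vbet
  fun_prop

lemma integral_Vbet (β : C(ProbabilityMeasure X × X, ℝ)) (ν ξ : ProbabilityMeasure X) :
    ∫ x, Vbet (fun p => β p) ν x ∂(ξ : Measure X) =
      (∫ x, β (ν, x) ∂(ξ : Measure X)) - ∫ x, β (ν, x) ∂(ν : Measure X) := by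
  refine (integral_sub (integrable_continuousMap (β.curry ν) _) (integrable_const _)).trans ?_
  simp

lemma abs_Vbet_le {β : C(ProbabilityMeasure X × X, ℝ)} {ν : ProbabilityMeasure X} {K : ℝ}
    (h : ∀ x, |β (ν, x)| ≤ K) (x : X) : |Vbet (fun p => β p) ν x| ≤ 2 * K := by
  have h1 := norm_integral_le_of_norm_le_const (μ := (ν : Measure X)) (f := fun x => β (ν, x))
    (C := K) (ae_of_all _ h)
  simp only [Real.norm_eq_abs, probReal_univ, mul_one] at h1
  have h2 := abs_sub (β (ν, x)) (∫ x', β (ν, x') ∂(ν : Measure X))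
  unfold Vbet
  linarith [h x]

lemma measurable_Vbet {Ω : Type*} [MeasurableSpace Ω] {B : Ω → C(ProbabilityMeasure X × X, ℝ)}
    {F : Ω → ProbabilityMeasure X} (hB : Measurable B) (hF : Measurable F) (z : X) :
    Measurable fun ω => Vbet (fun p => B ω p) (F ω) z := by
  have h1 : Measurable (Function.uncurry fun (ν : ProbabilityMeasure X) (ω : Ω) => B ω (ν, z)) :=
    measurable_uncurry_of_continuous_of_measurable (fun ω => by fun_prop)
      fun ν => (continuous_eval_const (ν, z)).measurable.comp hB
  have h2 : Measurable (Function.uncurry fun (ν : ProbabilityMeasure X) (ω : Ω) =>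
      ∫ x, B ω (ν, x) ∂(ν : Measure X)) :=
    measurable_uncurry_of_continuous_of_measurable (fun ω => continuous_integral_bet (B ω))
      fun ν => (continuous_integral_bet_right ν).measurable.comp hB
  have hp : Measurable fun ω => (F ω, ω) := hF.prodMk measurable_id
  exact (h1.comp hp).sub (h2.comp hp)

end Bets

variable (S : Strategy O) (F : ∀ n, Hn O n → ProbabilityMeasure (Hw O))

/-- The bet of the gambler `PG S` against the forecaster `F`. -/
def pgBet (n : ℕ) (y : Hn O n) : C(ProbabilityMeasure (Hw O) × Hw O, ℝ) :=
  PGfun O S n (y, fhist O F n y)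

/-- The payoff, as a function of the future, of the `n`-th bet of `PG S` against `F` after the
first `n` observations of `x`. -/
def pay (n : ℕ) (x z : Hw O) : ℝ :=
  Vbet (fun p => pgBet S F n (proj O n x) p) (F n (proj O n x)) z

/-- The total payoff, as a function of the future, of the bets `0, …, n - 1`. -/
def totalPay (n : ℕ) (x z : Hw O) : ℝ :=
  ∑ m ∈ Finset.range n, pay S F m x z

/-- The gambler `PG S` places the `n`-th bet. -/
def Played (n : ℕ) (x : Hw O) : Prop :=
  ∀ z ∈ cyl O (n - 1) (proj O (n - 1) x), ∀ z' ∈ cyl O (n - 1) (proj O (n - 1) x),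
    totalPay S F n x z - totalPay S F n x z' ≤ 1

variable {S F}

lemma pay_congr {n : ℕ} {x x' : Hw O} (h : proj O n x = proj O n x') :
    pay S F n x = pay S F n x' := by
  unfold pay
  rw [h]

lemma proj_eq_of_le {m n : ℕ} (hmn : m ≤ n) {x x' : Hw O} (h : proj O n x = proj O n x') :
    proj O m x = proj O m x' :=
  congrArg (trunc O hmn) h

lemma totalPay_congr {n : ℕ} {x x' : Hw O} (h : proj O (n - 1) x = proj O (n - 1) x') :
    totalPay S F n x = totalPay S F n x' := by
  ext z
  refine Finset.sum_congr rfl fun m hm => ?_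
  rw [pay_congr (proj_eq_of_le (Nat.le_pred_of_lt (Finset.mem_range.1 hm)) h)]

lemma continuous_pay (n : ℕ) (x : Hw O) : Continuous (pay S F n x) :=
  continuous_Vbet _ _

lemma continuous_totalPay (n : ℕ) (x : Hw O) : Continuous (totalPay S F n x) := by
  unfold totalPay
  exact continuous_finsetSum _ fun m _ => continuous_pay m x

lemma SVf_PGpre (n : ℕ) (x : Hw O) : SVf O (PGpre O S) F n x = totalPay S F n x x := by
  unfold totalPay SVf
  rw [← Fin.sum_univ_eq_sum_range (fun m => pay S F m x x)]
  rfl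

open scoped Classical in
lemma pgBet_eq (n : ℕ) (x : Hw O) :
    pgBet S F n (proj O n x) = if Played S F n x then S.S n (proj O n x) else 0 := by
  have hsv : (fun z => ∑ m : Fin n, Vbet (fun p => PGfun O S m
      (trunc O m.isLt.le (proj O n x), fun i : Fin m => fhist O F n (proj O n x)
        (i.castLE m.isLt.le)) p) (fhist O F n (proj O n x) m) z) = totalPay S F n x := by
    ext z
    unfold totalPay
    rw [← Fin.sum_univ_eq_sum_range (fun m => pay S F m x z)]
    rfl
  have hcl : cyl O (n - 1) (trunc O (Nat.sub_le n 1) (proj O n x)) =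
      cyl O (n - 1) (proj O (n - 1) x) := rfl
  unfold pgBet
  rw [PGfun]
  simp only [hsv, hcl]
  congr 1
  have hx : x ∈ cyl O (n - 1) (proj O (n - 1) x) := rfl
  have hK := isCompact_range (continuous_totalPay (S := S) (F := F) n x)
  have hsub := Set.image_subset_range (totalPay S F n x) (cyl O (n - 1) (proj O (n - 1) x))
  have hne : (totalPay S F n x '' cyl O (n - 1) (proj O (n - 1) x)).Nonempty := ⟨_, x, hx, rfl⟩
  refine propext ⟨fun h z hz z' hz' => ?_, fun h => ?_⟩
  · have h1 := le_csSup (hK.bddAbove.mono hsub) (Set.mem_image_of_mem _ hz)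
    have h2 := csInf_le (hK.bddBelow.mono hsub) (Set.mem_image_of_mem _ hz')
    linarith
  · rw [sub_le_iff_le_add]
    refine csSup_le hne ?_
    rintro _ ⟨z, hz, rfl⟩
    rw [← sub_le_iff_le_add']
    refine le_csInf hne ?_
    rintro _ ⟨z', hz', rfl⟩
    linarith [h z hz z' hz']

lemma pay_eq_zero {n : ℕ} {x : Hw O} (h : ¬ Played S F n x) : pay S F n x = 0 := by
  ext z
  unfold pay
  rw [pgBet_eq, if_neg h]
  simp [Vbet]

lemma pay_of_played {n : ℕ} {x : Hw O} (h : Played S F n x) :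
    pay S F n x = Vbet (fun p => S.S n (proj O n x) p) (F n (proj O n x)) := by
  ext z
  unfold pay
  rw [pgBet_eq, if_pos h]

/-- Overwrite the first `n` observations of `d` by those of `x`. -/
def overwrite (n : ℕ) (x d : Hw O) : Hw O := fun i => if i < n then x i else d i

lemma continuous_overwrite (n : ℕ) (x : Hw O) : Continuous (overwrite n x) := by
  refine continuous_pi fun i => ?_
  unfold overwrite
  split_ifs <;> fun_prop

lemma measurable_overwrite (n : ℕ) (d : Hw O) : Measurable fun x => overwrite n x d := by
  refine measurable_pi_iff.2 fun i => ?_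
  unfold overwrite
  split_ifs <;> fun_prop

lemma proj_overwrite (n : ℕ) (x d : Hw O) : proj O n (overwrite n x d) = proj O n x := by
  ext i
  simp [proj, overwrite]

lemma overwrite_eq_self {n : ℕ} {x z : Hw O} (h : proj O n z = proj O n x) :
    overwrite n x z = z := by
  ext i
  unfold overwrite
  split_ifs with hi
  · exact (congrFun h ⟨i, hi⟩).symm
  · rfl

lemma played_iff [Nonempty (Hw O)] (n : ℕ) (x : Hw O) : Played S F n x ↔
    ∀ i j : ℕ, totalPay S F n x (overwrite (n - 1) x (TopologicalSpace.denseSeq (Hw O) i)) -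
      totalPay S F n x (overwrite (n - 1) x (TopologicalSpace.denseSeq (Hw O) j)) ≤ 1 := by
  refine ⟨fun h i j => h _ (proj_overwrite _ _ _) _ (proj_overwrite _ _ _), fun h => ?_⟩
  have hc : Continuous fun d => totalPay S F n x (overwrite (n - 1) x d) :=
    (continuous_totalPay n x).comp (continuous_overwrite _ _)
  have hd := TopologicalSpace.denseRange_denseSeq (Hw O)
  have h1 : ∀ d d', totalPay S F n x (overwrite (n - 1) x d) -
      totalPay S F n x (overwrite (n - 1) x d') ≤ 1 := fun d d' =>
    hd.induction_on₂ (p := fun d d' => totalPay S F n x (overwrite (n - 1) x d) -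
      totalPay S F n x (overwrite (n - 1) x d') ≤ 1)
      (isClosed_le ((hc.comp continuous_fst).sub (hc.comp continuous_snd)) continuous_const)
      h d d'
  intro z hz z' hz'
  simpa only [overwrite_eq_self hz, overwrite_eq_self hz'] using h1 z z'

lemma measurable_eval_of_continuous {X Ω : Type*} [TopologicalSpace X] [PolishSpace X]
    [MeasurableSpace X] [BorelSpace X] [MeasurableSpace Ω] {v : Ω → X → ℝ}
    (hv : ∀ z, Measurable fun ω => v ω z) (hc : ∀ ω, Continuous (v ω)) {g : Ω → X}
    (hg : Measurable g) : Measurable fun ω => v ω (g ω) :=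
  (measurable_uncurry_of_continuous_of_measurable (u := fun z ω => v ω z) hc hv).comp
    (hg.prodMk measurable_id)

lemma measurable_pay [Nonempty (Hw O)] {Ω : Type*} [MeasurableSpace Ω] {p : Ω → Hw O}
    (hp : Measurable p) (hS : ∀ n, Measurable fun ω => S.S n (proj O n (p ω)))
    (hF : ∀ n, Measurable fun ω => F n (proj O n (p ω))) (n : ℕ) (z : Hw O) :
    Measurable fun ω => pay S F n (p ω) z := by
  classical
  induction n using Nat.strong_induction_on generalizing z with
  | _ n ih =>
    have hplayed : MeasurableSet {ω | Played S F n (p ω)} := by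
      simp only [played_iff, Set.ofPred_forall]
      refine MeasurableSet.iInter fun i => MeasurableSet.iInter fun j => ?_
      have hm : ∀ d, Measurable fun ω => totalPay S F n (p ω) (overwrite (n - 1) (p ω) d) :=
        fun d => measurable_eval_of_continuous (v := fun ω => totalPay S F n (p ω))
          (fun z => Finset.measurable_sum _ fun m hm => ih m (Finset.mem_range.1 hm) z)
          (fun ω => continuous_totalPay _ _) ((measurable_overwrite _ _).comp hp)
      exact measurableSet_le ((hm _).sub (hm _)) measurable_const
    have heq : (fun ω => pay S F n (p ω) z) = fun ω => if Played S F n (p ω) then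
        Vbet (fun q => S.S n (proj O n (p ω)) q) (F n (proj O n (p ω))) z else 0 := by
      ext ω
      split_ifs with h
      · rw [pay_of_played h]
      · rw [pay_eq_zero h]
        rfl
    rw [heq]
    exact Measurable.ite hplayed (measurable_Vbet (hS n) (hF n) z) measurable_const

lemma measurableSet_univMS {Y : Type*} [MeasurableSpace Y] {s : Set Y} :
    MeasurableSet[univMS Y] s ↔
      ∀ μ : Measure Y, IsProbabilityMeasure μ → NullMeasurableSet s μ := by
  unfold univMS
  simp only [MeasurableSpace.measurableSet_iInf]
  rfl

lemma measurable_id_univMS {Y : Type*} [MeasurableSpace Y] :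
    @Measurable Y Y (univMS Y) inferInstance id :=
  fun _ hs => measurableSet_univMS.2 fun _ _ => hs.nullMeasurableSet

lemma measurable_univMS_comp {X Y Z : Type*} [MeasurableSpace X] [MeasurableSpace Y]
    [MeasurableSpace Z] {f : Y → Z} (hf : @Measurable Y Z (univMS Y) inferInstance f) {g : X → Y}
    (hg : Measurable g) : @Measurable X Z (univMS X) inferInstance (fun x => f (g x)) := by
  intro s hs
  refine measurableSet_univMS.2 fun μ _ => ?_
  exact (measurableSet_univMS.1 (hf hs) (μ.map g)
    (Measure.isProbabilityMeasure_map hg.aemeasurable)).preimage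
      (hg.measurePreserving μ).quasiMeasurePreserving

lemma aemeasurable_of_univMS {X : Type*} [MeasurableSpace X] {f : X → ℝ}
    (hf : @Measurable X ℝ (univMS X) inferInstance f) (μ : Measure X) [IsProbabilityMeasure μ] :
    AEMeasurable f μ :=
  NullMeasurable.aemeasurable fun _ hs => measurableSet_univMS.1 (hf hs) μ inferInstance

/-- The supremum norm of the payoff of the `n`-th bet of `PG S` against `F`. -/
def betSize (S : Strategy O) (F : ∀ n, Hn O n → ProbabilityMeasure (Hw O)) [Nonempty (Hw O)]
    (n : ℕ) (x : Hw O) : ℝ :=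
  ⨆ i, |pay S F n x (TopologicalSpace.denseSeq (Hw O) i)|

section BetSize

variable [Nonempty (Hw O)]

lemma abs_pay_le_betSize (n : ℕ) (x z : Hw O) : |pay S F n x z| ≤ betSize S F n x := by
  have hb : BddAbove (Set.range fun z => |pay S F n x z|) :=
    (isCompact_range (continuous_pay n x).abs).bddAbove
  exact (TopologicalSpace.denseRange_denseSeq (Hw O)).induction_on
    (p := fun z => |pay S F n x z| ≤ betSize S F n x) z
    (isClosed_le (continuous_pay n x).abs continuous_const)
    fun i => le_ciSup (hb.mono (Set.range_comp_subset_range _ _)) i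

lemma betSize_nonneg (n : ℕ) (x : Hw O) : 0 ≤ betSize S F n x :=
  (abs_nonneg _).trans (abs_pay_le_betSize n x x)

lemma betSize_le {n : ℕ} {x : Hw O} {K : ℝ} (h : ∀ z, |pay S F n x z| ≤ K) :
    betSize S F n x ≤ K :=
  ciSup_le fun _ => h _

lemma betSize_congr {n : ℕ} {x x' : Hw O} (h : proj O n x = proj O n x') :
    betSize S F n x = betSize S F n x' := by
  unfold betSize
  rw [pay_congr h]

lemma betSize_eq_zero {n : ℕ} {x : Hw O} (h : ¬ Played S F n x) : betSize S F n x = 0 := by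
  unfold betSize
  simp [pay_eq_zero h]

lemma exists_betSize_le : ∃ C, 0 ≤ C ∧ ∀ n x, betSize S F n x ≤ C := by
  obtain ⟨C, hC⟩ := S.bounded
  refine ⟨2 * max C 0, by positivity, fun n x => ?_⟩
  by_cases h : Played S F n x
  · refine betSize_le fun z => ?_
    rw [pay_of_played h]
    exact abs_Vbet_le (fun z => (hC n _ _).trans (le_max_left _ _)) z
  · rw [betSize_eq_zero h]
    positivity

lemma measurable_univMS_pay
    (hF : ∀ n, @Measurable _ _ (univMS (Hn O n)) inferInstance (F n))
    (n : ℕ) (z : Hw O) :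
    @Measurable _ ℝ (univMS (Hw O)) inferInstance (fun x => pay S F n x z) :=
  @measurable_pay O _ _ _ _ _ S F _ (Hw O) (univMS (Hw O)) id measurable_id_univMS
    (fun n => measurable_univMS_comp (S.measurable n) (measurable_proj n))
    (fun n => measurable_univMS_comp (hF n) (measurable_proj n)) n z

lemma aemeasurable_pay
    (hF : ∀ n, @Measurable _ _ (univMS (Hn O n)) inferInstance (F n))
    (n : ℕ) (μ : Measure (Hw O)) [IsProbabilityMeasure μ] :
    AEMeasurable (fun x => pay S F n x x) μ :=
  aemeasurable_of_univMS (@measurable_eval_of_continuous (Hw O) (Hw O) _ _ _ _ (univMS (Hw O))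
    (pay S F n) (measurable_univMS_pay hF n) (continuous_pay n) id measurable_id_univMS) μ

lemma aemeasurable_betSize
    (hF : ∀ n, @Measurable _ _ (univMS (Hn O n)) inferInstance (F n))
    (n : ℕ) (μ : Measure (Hw O)) [IsProbabilityMeasure μ] :
    AEMeasurable (betSize S F n) μ := by
  unfold betSize
  refine AEMeasurable.iSup fun i => ?_
  have := aemeasurable_of_univMS (measurable_univMS_pay (S := S) hF n
    (TopologicalSpace.denseSeq (Hw O) i)) μ
  exact continuous_abs.measurable.comp_aemeasurable this

end BetSize

/-- The expected payoff of a savvy bet under an element `ξ` of the target set of measures. -/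
lemma IsSavvy.le_integral_Vbet {X : Type*} [TopologicalSpace X] [CompactSpace X] [PolishSpace X]
    [MeasurableSpace X] [BorelSpace X] {ρ : X → X → ℝ} {A : Set (ProbabilityMeasure X)} {ε : ℝ}
    {β : C(ProbabilityMeasure X × X, ℝ)} (hβ : IsSavvy ρ A ε (fun p => β p)) (hε : 0 < ε)
    {ν ξ : ProbabilityMeasure X} (hξ : ξ ∈ A) {b : ℝ}
    (hb : ∀ K, (∀ x, |Vbet (fun p => β p) ν x| ≤ K) → b ≤ K) :
    ε / 4 * b ≤ ∫ x, Vbet (fun p => β p) ν x ∂(ξ : Measure X) := by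
  obtain ⟨h1, h2⟩ := hβ.2 ν
  have h3 := abs_Vbet_le h1
  have h4 := hb _ h3
  rcases le_or_gt (KRdistSet ρ ν A) ε with h | h
  · rw [max_eq_right (by linarith)] at h3 h4
    have h0 : ∀ x, Vbet (fun p => β p) ν x = 0 := fun x => by
      have := h3 x
      rw [mul_zero] at this
      exact abs_nonpos_iff.1 this
    simp only [h0, integral_zero]
    nlinarith
  · rw [max_eq_left (by linarith)] at h4
    rw [integral_Vbet]
    refine le_trans ?_ (h2 ξ hξ)
    nlinarith

section Deterministic

variable [Nonempty (Hw O)]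

lemma totalPay_succ (n : ℕ) (x z : Hw O) :
    totalPay S F (n + 1) x z = totalPay S F n x z + pay S F n x z :=
  Finset.sum_range_succ _ _

/-- The accumulated size of the bets `0, …, n - 1`. -/
def totalSize (S : Strategy O) (F : ∀ n, Hn O n → ProbabilityMeasure (Hw O)) (n : ℕ)
    (x : Hw O) : ℝ :=
  ∑ m ∈ Finset.range n, betSize S F m x

lemma totalSize_succ (n : ℕ) (x : Hw O) :
    totalSize S F (n + 1) x = totalSize S F n x + betSize S F n x :=
  Finset.sum_range_succ _ _

lemma totalSize_congr {n : ℕ} {x x' : Hw O} (h : proj O n x = proj O n x') :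
    totalSize S F n x = totalSize S F n x' :=
  Finset.sum_congr rfl fun _ hm =>
    betSize_congr (proj_eq_of_le (Finset.mem_range.1 hm).le h)

lemma SVf_PGpre_of_mem {n : ℕ} {x z : Hw O} (hz : z ∈ cyl O (n - 1) (proj O (n - 1) x)) :
    SVf O (PGpre O S) F n z = totalPay S F n x z := by
  rw [SVf_PGpre, totalPay_congr hz]

lemma cyl_mono {m n : ℕ} (h : m ≤ n) (x : Hw O) :
    cyl O n (proj O n x) ⊆ cyl O m (proj O m x) :=
  fun _ hz => proj_eq_of_le h hz

lemma exists_cyl_subset {x : Hw O} {U : Set (Hw O)} (hU : U ∈ 𝓝 x) :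
    ∃ n, cyl O n (proj O n x) ⊆ U := by
  rw [nhds_pi, Filter.mem_pi] at hU
  obtain ⟨I, hI, t, ht, htU⟩ := hU
  obtain ⟨n, hn⟩ := hI.bddAbove
  refine ⟨n + 1, fun z hz => htU fun i hi => ?_⟩
  have : z i = x i := congrFun hz ⟨i, Nat.lt_succ_of_le (hn hi)⟩
  rw [this]
  exact mem_of_mem_nhds (ht i)

lemma eventually_played_of_summable {x : Hw O} (h : Summable fun n => betSize S F n x) :
    ∀ᶠ n in atTop, Played S F n x := by
  obtain ⟨k, hk⟩ := ((tendsto_sum_nat_add fun n => betSize S F n x).eventually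
    (gt_mem_nhds (show (0 : ℝ) < 1 / 4 by norm_num))).exists
  have hU : {z | |totalPay S F k x z - totalPay S F k x x| < 1 / 4} ∈ 𝓝 x :=
    Metric.tendsto_nhds.1 ((continuous_totalPay (S := S) (F := F) k x).tendsto x) (1 / 4)
      (by norm_num)
  obtain ⟨m, hm⟩ := exists_cyl_subset hU
  filter_upwards [eventually_ge_atTop (max k (m + 1))] with n hn
  have hkn : k ≤ n := (le_max_left _ _).trans hn
  have hmn : m ≤ n - 1 := Nat.le_pred_of_lt ((le_max_right k (m + 1)).trans hn)
  have htail : ∀ z, |totalPay S F n x z - totalPay S F k x z| < 1 / 4 := fun z => by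
    obtain ⟨j, rfl⟩ := Nat.exists_eq_add_of_le' hkn
    have h1 : totalPay S F (j + k) x z - totalPay S F k x z =
        ∑ i ∈ Finset.range j, pay S F (i + k) x z := by
      unfold totalPay
      rw [add_comm j k, Finset.sum_range_add, add_sub_cancel_left]
      simp only [add_comm]
    rw [h1]
    calc _ ≤ ∑ i ∈ Finset.range j, betSize S F (i + k) x :=
          (Finset.abs_sum_le_sum_abs _ _).trans
            (Finset.sum_le_sum fun i _ => abs_pay_le_betSize _ _ _)
      _ ≤ ∑' i, betSize S F (i + k) x :=
          ((summable_nat_add_iff k).2 h).sum_le_tsum _ fun i _ => betSize_nonneg _ _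
      _ < _ := hk
  intro z hz z' hz'
  have a1 := abs_lt.1 (htail z)
  have a2 := abs_lt.1 (htail z')
  have a3 := abs_lt.1 (Set.mem_ofPred.1 (hm (cyl_mono hmn x hz)))
  have a4 := abs_lt.1 (Set.mem_ofPred.1 (hm (cyl_mono hmn x hz')))
  linarith [a1.1, a1.2, a2.1, a2.2, a3.1, a3.2, a4.1, a4.2]

lemma summable_betSize_of_dominates (hdom : Dominates O F (PGpre O S)) {x : Hw O} {R η C : ℝ}
    (hR : 0 ≤ R) (hη : 0 < η) (hC0 : 0 ≤ C) (hC : ∀ n, betSize S F n x ≤ C)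
    (hlow : ∀ n, Played S F n x → ∀ z ∈ cyl O (n - 1) (proj O (n - 1) x),
      η * totalSize S F n x - R ≤ totalPay S F n x z) :
    Summable fun n => betSize S F n x := by
  have hts : ∀ n, 0 ≤ totalSize S F n x := fun n =>
    Finset.sum_nonneg fun m _ => betSize_nonneg m x
  have hlow' : ∀ n, ∀ z ∈ cyl O (n - 1) (proj O (n - 1) x), -(R + C) ≤ totalPay S F n x z := by
    intro n
    induction n with
    | zero =>
      intro z _
      simp only [totalPay, Finset.range_zero, Finset.sum_empty]
      linarith
    | succ n ih =>
      intro z hz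
      have hz' := cyl_mono (Nat.sub_le n 1) x hz
      rw [totalPay_succ]
      by_cases h : Played S F n x
      · have h1 := hlow n h z hz'
        have h2 := (abs_le.1 ((abs_pay_le_betSize n x z).trans (hC n))).1
        have := mul_nonneg hη.le (hts n)
        linarith
      · rw [pay_eq_zero h]
        simpa using ih z hz'
  have hself : ∀ n, x ∈ cyl O n (proj O n x) := fun n => rfl
  have hbelow : BddBelow (Set.range fun n => SVfMin O (PGpre O S) F n (proj O (n - 1) x)) := by
    refine ⟨-(R + C), ?_⟩
    rintro _ ⟨n, rfl⟩
    refine le_csInf ⟨_, x, hself _, rfl⟩ ?_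
    rintro _ ⟨z, hz, rfl⟩
    rw [SVf_PGpre_of_mem hz]
    exact hlow' n z hz
  obtain ⟨T, hT⟩ := hdom x hbelow
  have hup : ∀ n, totalPay S F n x x ≤ T := fun n => by
    refine le_trans ?_ (hT (Set.mem_range_self n))
    refine le_csSup ?_ ⟨x, hself _, SVf_PGpre_of_mem (hself _)⟩
    refine (isCompact_range (continuous_totalPay (S := S) (F := F) n x)).bddAbove.mono ?_
    rintro _ ⟨z, hz, rfl⟩
    rw [SVf_PGpre_of_mem hz]
    exact Set.mem_range_self z
  have hT0 : 0 ≤ T := by simpa [totalPay] using hup 0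
  refine summable_of_sum_range_le (c := (T + R) / η + C) (fun n => betSize_nonneg n x) fun n => ?_
  change totalSize S F n x ≤ _
  induction n with
  | zero =>
    simp only [totalSize, Finset.range_zero, Finset.sum_empty]
    positivity
  | succ n ih =>
    rw [totalSize_succ]
    by_cases h : Played S F n x
    · refine add_le_add ?_ (hC n)
      rw [le_div_iff₀ hη]
      linarith [hlow n h x (hself _), hup n]
    · rw [betSize_eq_zero h]
      simpa using ih

end Deterministic

section Wealth

variable [Nonempty (Hw O)]

/-- The exponentially discounted total payoff, compensated by the accumulated bet size. -/
def expLoss (S : Strategy O) (F : ∀ n, Hn O n → ProbabilityMeasure (Hw O)) (l α : ℝ) (n : ℕ)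
    (x : Hw O) : ℝ :=
  Real.exp (-l * (totalPay S F n x x - α / 2 * totalSize S F n x))

lemma expLoss_of_proj_eq {l α : ℝ} {n : ℕ} {x z : Hw O} (h : proj O n z = proj O n x) :
    expLoss S F l α n z =
      Real.exp (-l * (totalPay S F n x z - α / 2 * totalSize S F n x)) := by
  unfold expLoss
  rw [totalPay_congr (proj_eq_of_le (Nat.sub_le n 1) h), totalSize_congr h]

lemma expLoss_succ_of_proj_eq {l α : ℝ} {n : ℕ} {x z : Hw O} (h : proj O n z = proj O n x) :
    expLoss S F l α (n + 1) z = Real.exp (-l * (totalPay S F n x z + pay S F n x z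
      - α / 2 * (totalSize S F n x + betSize S F n x))) := by
  unfold expLoss
  rw [totalPay_succ, totalSize_succ, totalPay_congr (proj_eq_of_le (Nat.sub_le n 1) h),
    totalSize_congr h, betSize_congr h, pay_congr h]

lemma integrable_expLoss (hF : ∀ n, @Measurable _ _ (univMS (Hn O n)) inferInstance (F n))
    (μ : Measure (Hw O)) [IsProbabilityMeasure μ] {l α : ℝ} (hl : 0 ≤ l) (hα : 0 ≤ α) (n : ℕ) :
    Integrable (expLoss S F l α n) μ := by
  obtain ⟨C, hC0, hC⟩ := exists_betSize_le (S := S) (F := F)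
  have hs : ∀ x, |totalPay S F n x x| ≤ n * C := fun x => by
    calc _ ≤ ∑ m ∈ Finset.range n, |pay S F m x x| := Finset.abs_sum_le_sum_abs _ _
      _ ≤ ∑ m ∈ Finset.range n, C := Finset.sum_le_sum fun m _ =>
          (abs_pay_le_betSize m x x).trans (hC m x)
      _ = _ := by simp
  have hb : ∀ x, totalSize S F n x ≤ n * C := fun x => by
    calc _ ≤ ∑ m ∈ Finset.range n, C := Finset.sum_le_sum fun m _ => hC m x
      _ = _ := by simp
  have h1 : AEMeasurable (fun x => totalPay S F n x x) μ := by
    unfold totalPay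
    exact Finset.aemeasurable_fun_sum _ fun m _ => aemeasurable_pay hF m μ
  have h2 : AEMeasurable (fun x => totalSize S F n x) μ := by
    unfold totalSize
    exact Finset.aemeasurable_fun_sum _ fun m _ => aemeasurable_betSize hF m μ
  have h3 : AEMeasurable (expLoss S F l α n) μ := by
    unfold expLoss
    fun_prop
  refine Integrable.of_bound h3.aestronglyMeasurable
    (Real.exp (l * (n * C) + l * (α / 2 * (n * C)))) (ae_of_all _ fun x => ?_)
  rw [expLoss, Real.norm_eq_abs, abs_of_pos (Real.exp_pos _)]
  apply Real.exp_le_exp.2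
  have h4 := mul_le_mul_of_nonneg_left (abs_le.1 (hs x)).1 hl
  have h5 := mul_le_mul_of_nonneg_left (mul_le_mul_of_nonneg_left (hb x)
    (show 0 ≤ α / 2 by linarith)) hl
  linarith

lemma integral_expLoss_succ_le {κ : Measure (Hw O)} [IsProbabilityMeasure κ] {n : ℕ} {x : Hw O}
    (hfib : ∀ᵐ z ∂κ, proj O n z = proj O n x) {l α C : ℝ} (hC : betSize S F n x ≤ C)
    (hmean : α * betSize S F n x ≤ ∫ z, pay S F n x z ∂κ) (hα0 : 0 < α) (hα1 : α ≤ 1)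
    (hl0 : 0 < l) (hl1 : l ≤ 1) (hl : l * (4 + 12 * C) ≤ α / 2) :
    ∫ z, expLoss S F l α (n + 1) z ∂κ ≤ ∫ z, expLoss S F l α n z ∂κ := by
  rw [integral_congr_ae (hfib.mono fun z hz => expLoss_succ_of_proj_eq hz),
    integral_congr_ae (hfib.mono fun z hz => expLoss_of_proj_eq hz)]
  by_cases h : Played S F n x
  · refine integral_exp_step κ (s₀ := totalPay S F n x x)
      (continuous_totalPay n x).measurable.aemeasurable
      (continuous_pay n x).measurable.aemeasurable ?_
      (ae_of_all _ fun z => abs_pay_le_betSize n x z) hC hmean hα0 hα1 hl0 hl1 hl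
    filter_upwards [hfib] with z hz
    have hz' : z ∈ cyl O (n - 1) (proj O (n - 1) x) := proj_eq_of_le (Nat.sub_le n 1) hz
    rw [abs_le]
    constructor
    · linarith [h x rfl z hz']
    · exact h z hz' x rfl
  · simp [pay_eq_zero h, betSize_eq_zero h]

lemma le_totalPay_of_integral_expLoss_le {κ : Measure (Hw O)} [IsProbabilityMeasure κ] {n : ℕ}
    {x : Hw O} (hfib : ∀ᵐ z ∂κ, proj O n z = proj O n x) {l α R : ℝ} (hl : 0 < l) (hR : 0 < R)
    (hint : ∫ z, expLoss S F l α n z ∂κ ≤ R) (h : Played S F n x) {z : Hw O}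
    (hz : z ∈ cyl O (n - 1) (proj O (n - 1) x)) :
    α / 2 * totalSize S F n x - (1 + Real.log R / l) ≤ totalPay S F n x z := by
  rw [integral_congr_ae (hfib.mono fun z hz => expLoss_of_proj_eq hz)] at hint
  have hc : Continuous fun w =>
      Real.exp (-l * (totalPay S F n x w - α / 2 * totalSize S F n x)) := by
    have := continuous_totalPay (S := S) (F := F) n x
    fun_prop
  have h1 : Real.exp (-l * (totalPay S F n x z + 1 - α / 2 * totalSize S F n x)) ≤ R := by
    refine le_trans ?_ hint
    calc _ = ∫ w, Real.exp (-l * (totalPay S F n x z + 1 - α / 2 * totalSize S F n x)) ∂κ := by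
          simp
      _ ≤ _ := by
          refine integral_mono_ae (integrable_const _) (integrable_continuousMap ⟨_, hc⟩ κ) ?_
          filter_upwards [hfib] with w hw
          apply Real.exp_le_exp.2
          have := h w (proj_eq_of_le (Nat.sub_le n 1) hw) z hz
          nlinarith
  rw [← Real.le_log_iff_exp_le hR] at h1
  have h2 : -(totalPay S F n x z + 1 - α / 2 * totalSize S F n x) ≤ Real.log R / l := by
    rw [le_div_iff₀ hl]
    linarith
  linarith

end Wealth

end

/-- Corollary 5.2 of the paper: if `S` is a gambling strategy whose bets
are `(M_n(y), ε)`-savvy and `F` dominates `PG S`, then for every `μ ∈ M`, `μ`-almost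
surely `limsup_n D^{ρ_n}(F_n(x_{:n}), M_n(x_{:n})) ≤ ε`. -/
theorem statement18 (ρ : ℕ → Hw O → Hw O → ℝ) (hρ : ∀ n, IsMetrization (ρ n))
    (M : Set (ProbabilityMeasure (Hw O)))
    (N : ∀ n : ℕ, Hn O n → Set (ProbabilityMeasure (Hw O)))
    (hN : ∀ n, IsRUB (proj O n) M (N n))
    (ε : ℝ) (hε : 0 < ε) (S : Strategy O)
    (hS : ∀ n y, IsSavvy (ρ n) (N n y) ε (fun p => S.S n y p))
    (F : Forecaster O) (hdom : Dominates O F.F (PGpre O S)) :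
    ∀ μ ∈ M, ∀ᵐ x ∂(μ : Measure (Hw O)), ∀ δ > ε, ∀ᶠ n in Filter.atTop,
      KRdistSet (ρ n) (F.F n (proj O n x)) (N n (proj O n x)) < δ := by
  intro μ hμ
  have : Nonempty (Hw O) := nonempty_of_isProbabilityMeasure (μ : Measure (Hw O))
  set κ := condProjPM (μ : Measure (Hw O))
  obtain ⟨C, hC0, hC⟩ := exists_betSize_le (S := S) (F := F.F)
  set α : ℝ := min (ε / 4) 1
  have hα0 : 0 < α := lt_min (by linarith) one_pos
  have hα1 : α ≤ 1 := min_le_right _ _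
  set l : ℝ := α / 2 / (4 + 12 * C)
  have hl0 : 0 < l := by positivity
  have hlC : l * (4 + 12 * C) ≤ α / 2 := (div_mul_cancel₀ _ (by positivity)).le
  have hl1 : l ≤ 1 := by nlinarith
  have hfib : ∀ᵐ x ∂(μ : Measure (Hw O)), ∀ n,
      ∀ᵐ z ∂(κ n (proj O n x) : Measure (Hw O)), proj O n z = proj O n x :=
    ae_all_iff.2 fun n => ae_of_ae_map (measurable_proj n).aemeasurable
      (ae_condProj_fiber (μ : Measure (Hw O)) n)
  have hmem : ∀ᵐ x ∂(μ : Measure (Hw O)), ∀ n, κ n (proj O n x) ∈ N n (proj O n x) :=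
    ae_all_iff.2 fun n => ae_of_ae_map (measurable_proj n).aemeasurable
      ((hN n).cond μ hμ _ (isRCP_condProjPM (μ : Measure (Hw O)) n))
  have hbd := ae_exists_bound_integral_condProj (μ : Measure (Hw O)) (expLoss S F.F l α)
    (fun n x => (Real.exp_pos _).le)
    (integrable_expLoss F.measurable (μ : Measure (Hw O)) hl0.le hα0.le) (fun n => by
      filter_upwards [hfib, hmem] with x hx hxN
      refine integral_expLoss_succ_le (hx n) (hC n x) ?_ hα0 hα1 hl0 hl1 hlC
      have hb0 := betSize_nonneg (S := S) (F := F.F) n x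
      by_cases h : Played S F.F n x
      · refine (mul_le_mul_of_nonneg_right (min_le_left _ _) hb0).trans ?_
        rw [pay_of_played h]
        refine (hS n (proj O n x)).le_integral_Vbet hε (hxN n) fun K hK => betSize_le ?_
        rwa [pay_of_played h]
      · rw [betSize_eq_zero h, pay_eq_zero h]
        simp)
  filter_upwards [hfib, hmem, hbd] with x hx hxN ⟨R, hR⟩ δ hδ
  have hR1 : 1 ≤ max R 1 := le_max_right _ _
  have hsum := summable_betSize_of_dominates hdom (x := x) (η := α / 2)
    (R := 1 + Real.log (max R 1) / l) (by have := Real.log_nonneg hR1; positivity)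
    (by positivity) hC0 (fun n => hC n x) fun n hn z hz =>
      le_totalPay_of_integral_expLoss_le (hx n) hl0 (by positivity)
        ((hR n).trans (le_max_left _ _)) hn hz
  have hpos : 0 < 1 / 2 * (δ - ε) * δ :=
    mul_pos (mul_pos (by norm_num) (sub_pos.2 hδ)) (hε.trans hδ)
  filter_upwards [eventually_played_of_summable hsum,
    hsum.tendsto_atTop_zero.eventually (gt_mem_nhds hpos)] with n hn hsmall
  by_contra! hge
  have h1 := ((hS n (proj O n x)).2 (F.F n (proj O n x))).2 _ (hxN n)
  rw [← integral_Vbet, ← pay_of_played hn] at h1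
  have h2 := norm_integral_le_of_norm_le_const (μ := (κ n (proj O n x) : Measure (Hw O)))
    (f := pay S F.F n x) (ae_of_all _ fun z => abs_pay_le_betSize n x z)
  simp only [probReal_univ, mul_one] at h2
  have h3 := (le_abs_self _).trans h2
  have h4 : 1 / 2 * (δ - ε) * δ ≤ 1 / 2 * (KRdistSet (ρ n) (F.F n (proj O n x))
      (N n (proj O n x)) - ε) * KRdistSet (ρ n) (F.F n (proj O n x)) (N n (proj O n x)) :=
    mul_le_mul (by linarith) hge (by linarith) (by linarith)
  linarith

end
end

section
/- Let X be a compact Polish space, d ∈ ℕ, Y a compact subset of ℝ^d (with the Euclidean metric), π : X → Y continuous, and μ ∈ P(X). Then for π_*μ-almost every y ∈ Y, the conditional probability measures μ | π^{-1}(B_r(y)) converge weakly, as r → 0, to (μ|π)(y), the value at y of a regular conditional probability of μ given π. -/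
open MeasureTheory Filter Set Topology
open scoped NNReal ENNReal

/-- Averages over open balls inherit limits of averages over closed balls with the same centre. -/
theorem tendsto_average_ball_of_closedBall {α E : Type*} [PseudoMetricSpace α] [MeasurableSpace α]
    [OpensMeasurableSpace α] [NormedAddCommGroup E] [NormedSpace ℝ E] {ν : Measure α}
    [IsFiniteMeasure ν] {f : α → E} (hf : Integrable f ν) {x : α} {c : E}
    (hpos : ∀ r > 0, ν (Metric.ball x r) ≠ 0)
    (h : Tendsto (fun r => ⨍ y in Metric.closedBall x r, f y ∂ν) (𝓝[>] 0) (𝓝 c)) :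
    Tendsto (fun r => ⨍ y in Metric.ball x r, f y ∂ν) (𝓝[>] 0) (𝓝 c) := by
  rw [(closed_nhds_basis c).tendsto_right_iff]
  rintro C ⟨hC, hCc⟩
  obtain ⟨δ, hδ, hδC⟩ := mem_nhdsGT_iff_exists_Ioo_subset.1 (h hC)
  filter_upwards [Ioo_mem_nhdsGT hδ] with r hr
  obtain ⟨u, hu, hur, hulim⟩ := exists_seq_strictMono_tendsto' hr.1
  have hunion : ⋃ n, Metric.closedBall x (u n) = Metric.ball x r := by
    ext z
    simp only [mem_iUnion, Metric.mem_closedBall, Metric.mem_ball]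
    exact ⟨fun ⟨n, hn⟩ => hn.trans_lt (hur n).2,
      fun hz => ((hulim.eventually (lt_mem_nhds hz)).exists).imp fun _ hn => hn.le⟩
  have hmono : Monotone fun n => Metric.closedBall x (u n) :=
    fun _ _ hmn => Metric.closedBall_subset_closedBall (hu.monotone hmn)
  have hint := tendsto_setIntegral_of_monotone (μ := ν) (f := f)
    (fun n => (Metric.isClosed_closedBall (x := x) (ε := u n)).measurableSet) hmono
    hf.integrableOn
  have hmeas := (ENNReal.tendsto_toReal (measure_ne_top ν _)).comp
    (tendsto_measure_iUnion_atTop (μ := ν) hmono)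
  rw [hunion] at hint hmeas
  have havg := (hmeas.inv₀ (ENNReal.toReal_ne_zero.2 ⟨hpos r hr.1, measure_ne_top ν _⟩)).smul hint
  rw [id, setAverage_eq]
  refine hCc.mem_of_tendsto havg (Eventually.of_forall fun n => ?_)
  have := hδC ⟨(hur n).1, (hur n).2.trans hr.2⟩
  rwa [mem_preimage, setAverage_eq] at this

/-- **Lebesgue–Besicovitch differentiation theorem** for open balls. -/
theorem ae_tendsto_average_ball {α E : Type*} [MetricSpace α] [MeasurableSpace α] [BorelSpace α]
    [SecondCountableTopology α] [HasBesicovitchCovering α] [NormedAddCommGroup E]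
    [NormedSpace ℝ E] [CompleteSpace E] {ν : Measure α} [IsFiniteMeasure ν] {f : α → E}
    (hf : Integrable f ν) :
    ∀ᵐ x ∂ν, Tendsto (fun r => ⨍ y in Metric.ball x r, f y ∂ν) (𝓝[>] 0) (𝓝 (f x)) := by
  filter_upwards [(Besicovitch.vitaliFamily ν).ae_tendsto_average hf.locallyIntegrable,
    (Besicovitch.vitaliFamily ν).ae_eventually_measure_pos] with x hx hpos
  refine tendsto_average_ball_of_closedBall hf (fun r hr => ?_)
    (hx.comp (Besicovitch.tendsto_filterAt ν x))
  obtain ⟨s, hs, hsr⟩ := (((Besicovitch.tendsto_filterAt ν x).eventually hpos).and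
    (Ioo_mem_nhdsGT hr)).exists
  exact (hs.trans_le (measure_mono (Metric.closedBall_subset_ball hsr.2))).ne'

theorem ae_tendsto_average_ball_subtype {α E : Type*} [MetricSpace α] [MeasurableSpace α]
    [BorelSpace α] [SecondCountableTopology α] [HasBesicovitchCovering α] [NormedAddCommGroup E]
    [NormedSpace ℝ E] [CompleteSpace E] {Y : Set α} (hY : MeasurableSet Y) {ν : Measure Y}
    [IsFiniteMeasure ν] {g : Y → E} (hg : Integrable g ν) :
    ∀ᵐ y ∂ν, Tendsto (fun r => ⨍ z in Metric.ball y r, g z ∂ν) (𝓝[>] 0) (𝓝 (g y)) := by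
  have hemb : MeasurableEmbedding (Subtype.val : Y → α) := MeasurableEmbedding.subtype_coe hY
  have hext (y : Y) : Function.extend Subtype.val g 0 (y : α) = g y :=
    Subtype.val_injective.extend_apply g 0 y
  have hint : Integrable (Function.extend Subtype.val g 0) (ν.map Subtype.val) := by
    rw [hemb.integrable_map_iff]
    exact hg.congr (Eventually.of_forall fun y => (hext y).symm)
  filter_upwards [hemb.ae_map_iff.1 (ae_tendsto_average_ball hint)] with y hy
  rw [hext] at hy
  refine hy.congr fun r => ?_
  rw [setAverage_eq, setAverage_eq, hemb.setIntegral_map, measureReal_def, hemb.map_apply]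
  simp only [hext]
  rfl

/-- Weak convergence of subprobability measures may be tested on a dense set of functions. -/
theorem tendsto_integral_of_denseRange {X ι S : Type*} [TopologicalSpace X] [CompactSpace X]
    [MeasurableSpace X] [OpensMeasurableSpace X] {l : Filter ι} {m : ι → Measure X}
    {m₀ : Measure X} (hm : ∀ i, m i univ ≤ 1) (hm₀ : m₀ univ ≤ 1) {e : S → C(X, ℝ)}
    (he : DenseRange e) (h : ∀ s, Tendsto (fun i => ∫ x, e s x ∂m i) l (𝓝 (∫ x, e s x ∂m₀)))
    (f : C(X, ℝ)) : Tendsto (fun i => ∫ x, f x ∂m i) l (𝓝 (∫ x, f x ∂m₀)) := by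
  have hlip (ρ : Measure X) (hρ : ρ univ ≤ 1) :
      LipschitzWith 1 fun f : C(X, ℝ) => ∫ x, f x ∂ρ := by
    have : IsFiniteMeasure ρ := ⟨hρ.trans_lt ENNReal.one_lt_top⟩
    have hi (f : C(X, ℝ)) : Integrable f ρ := by
      refine Integrable.of_bound f.continuous.measurable.aestronglyMeasurable ‖f‖
        (Eventually.of_forall f.norm_coe_le_norm)
    refine LipschitzWith.of_dist_le_mul fun f g => ?_
    rw [dist_eq_norm, ← integral_sub (hi f) (hi g), dist_eq_norm, NNReal.coe_one, one_mul]
    calc ‖∫ x, (f x - g x) ∂ρ‖ ≤ ‖f - g‖ * ρ.real univ :=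
          norm_integral_le_of_norm_le_const (Eventually.of_forall (f - g).norm_coe_le_norm)
      _ ≤ ‖f - g‖ := mul_le_of_le_one_right (norm_nonneg _)
          (ENNReal.toReal_le_of_le_ofReal zero_le_one (by simpa using hρ))
  have hequi : Equicontinuous fun i (f : C(X, ℝ)) => ∫ x, f x ∂m i :=
    (LipschitzWith.uniformEquicontinuous _ 1 fun i => hlip _ (hm i)).equicontinuous
  exact isClosed_property he (hequi.isClosed_setOfPred_tendsto (hlip m₀ hm₀).continuous) h f

theorem cond_univ_le_one {X : Type*} [MeasurableSpace X] (μ : Measure X) (s : Set X) :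
    ProbabilityTheory.cond μ s univ ≤ 1 := by
  simp [ProbabilityTheory.cond]

namespace IsRCP

variable {X Y : Type*} [MeasurableSpace X] [MeasurableSpace Y] {μ : Measure X} {π : X → Y}
  {κ : Y → ProbabilityMeasure X}

/-- The Markov kernel underlying a regular conditional probability. -/
def kernel (hκ : IsRCP μ π κ) : ProbabilityTheory.Kernel Y X := ⟨fun y => κ y, hκ.1⟩

theorem kernel_apply (hκ : IsRCP μ π κ) (y : Y) : hκ.kernel y = κ y := rfl

theorem restrict_preimage_eq_bind (hκ : IsRCP μ π κ) {t : Set Y} (ht : MeasurableSet t) :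
    μ.restrict (π ⁻¹' t) = ((μ.map π).restrict t).bind hκ.kernel := by
  ext s hs
  rw [Measure.restrict_apply hs, Measure.bind_apply hs hκ.kernel.aemeasurable, hκ.2.1 s hs t ht]
  rfl

theorem setIntegral_preimage_eq (hκ : IsRCP μ π κ) {t : Set Y} (ht : MeasurableSet t)
    {f : X → ℝ} (hf : IntegrableOn f (π ⁻¹' t) μ) :
    ∫ x in π ⁻¹' t, f x ∂μ = ∫ y in t, ∫ x, f x ∂(κ y : Measure X) ∂(μ.map π) := by
  rw [IntegrableOn, hκ.restrict_preimage_eq_bind ht] at hf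
  rw [hκ.restrict_preimage_eq_bind ht]
  rw [Measure.comp_eq_comp_const_apply] at hf ⊢
  rw [ProbabilityTheory.Kernel.integral_comp hf]
  simp [kernel_apply]

theorem integral_cond_preimage_eq (hκ : IsRCP μ π κ) (hπ : Measurable π) {t : Set Y}
    (ht : MeasurableSet t) {f : X → ℝ} (hf : Integrable f μ) :
    ∫ x, f x ∂(ProbabilityTheory.cond μ (π ⁻¹' t)) =
      ⨍ y in t, ∫ x, f x ∂(κ y : Measure X) ∂(μ.map π) := by
  rw [ProbabilityTheory.cond, integral_smul_measure, hκ.setIntegral_preimage_eq ht hf.integrableOn,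
    setAverage_eq, ENNReal.toReal_inv, map_measureReal_apply hπ ht, measureReal_def]

theorem integrable_integral (hκ : IsRCP μ π κ) {f : X → ℝ} (hf : Integrable f μ) :
    Integrable (fun y => ∫ x, f x ∂(κ y : Measure X)) (μ.map π) := by
  have hμ := hκ.restrict_preimage_eq_bind MeasurableSet.univ
  rw [preimage_univ, Measure.restrict_univ, Measure.restrict_univ] at hμ
  rw [hμ, Measure.comp_eq_comp_const_apply] at hf
  simpa [kernel_apply] using hf.integral_comp

end IsRCP

/-- Proposition B.2 of the paper, differentiation: for `π : X → Y`
continuous with `Y` a compact subset of `ℝ^d`, the conditional measures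
`μ | π⁻¹(B_r(y))` converge weakly as `r → 0⁺` to a regular conditional probability
`(μ|π)(y)`, for `π_*μ`-almost every `y`. -/
theorem statement19 {X : Type*} [TopologicalSpace X] [CompactSpace X] [PolishSpace X]
    [MeasurableSpace X] [BorelSpace X]
    {d : ℕ} {Y : Set (EuclideanSpace ℝ (Fin d))} (hYc : IsCompact Y)
    (π : X → Y) (hπ : Continuous π) (μ : ProbabilityMeasure X)
    (κ : Y → ProbabilityMeasure X) (hκ : IsRCP (μ : Measure X) π κ) :
    ∀ᵐ y ∂((μ : Measure X).map π), ∀ f : C(X, ℝ),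
      Filter.Tendsto
        (fun r : ℝ =>
          ∫ x, f x ∂(ProbabilityTheory.cond (μ : Measure X) (π ⁻¹' Metric.ball y r)))
        (nhdsWithin 0 (Set.Ioi 0)) (nhds (∫ x, f x ∂(κ y : Measure X))) := by
  have hint (f : C(X, ℝ)) : Integrable f (μ : Measure X) :=
    Integrable.of_bound f.continuous.measurable.aestronglyMeasurable ‖f‖
      (Eventually.of_forall f.norm_coe_le_norm)
  have : IsFiniteMeasure ((μ : Measure X).map π) := inferInstance
  filter_upwards [ae_all_iff.2 fun n => ae_tendsto_average_ball_subtype hYc.measurableSet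
    (hκ.integrable_integral (hint (TopologicalSpace.denseSeq C(X, ℝ) n)))] with y hy
  refine tendsto_integral_of_denseRange (fun r => cond_univ_le_one _ _) prob_le_one
    (TopologicalSpace.denseRange_denseSeq C(X, ℝ)) fun n => (hy n).congr fun r => ?_
  exact (hκ.integral_cond_preimage_eq hπ.measurable Metric.isOpen_ball.measurableSet
    (hint _)).symm
end
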